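/- arXiv:2508.20270 — 6 statements merged into one kernel-verified Lean document; each statement's English description precedes it below -/
import Mathlib

section
/- Let V have basis v1,…,vg,w1,…,wg over a field K with at least 2g+1 distinct elements a1,…,a_{2g+1}, and extend C_a (given by C_a(v)=L_a(v)K_a) to ⋀^2 V as a derivation. Then an element x = Σ_{i,j} c_{ij} v_i ∧ w_j of the subspace V_{1,1} = span{v_i ∧ w_j} lies in ⋂_m ker C_{a_m} if and only if x is a scalar multiple of δ = v1∧w1 + v2∧w2 + ⋯ + vg∧wg. -/
noncomputable section

/-- The `2g`-dimensional vector space `V` with basis `v₁,…,v_g, w₁,…,w_g`. -/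
abbrev Vg (K : Type*) (g : ℕ) := (Fin g ⊕ Fin g) → K

variable {K : Type*} [Field K]

def vv (g : ℕ) (i : Fin g) : Vg K g := Pi.single (Sum.inl i) 1

def ww (g : ℕ) (i : Fin g) : Vg K g := Pi.single (Sum.inr i) 1

def Kvec (g : ℕ) (a : K) : Vg K g := Sum.elim (fun _ => 0) (fun k => a ^ (k : ℕ))

def Lfun (g : ℕ) (a : K) : Vg K g →ₗ[K] K :=
  ∑ k : Fin g, a ^ (k : ℕ) • (LinearMap.proj (Sum.inl k) : Vg K g →ₗ[K] K)

/-- `C_a(v) = L_a(v)·K_a` -/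
def Cmap (g : ℕ) (a : K) : Vg K g →ₗ[K] Vg K g := (Lfun g a).smulRight (Kvec g a)

open Polynomial in
/-- Polynomials of degree `< g` with `X ^ j * P k = X ^ k * P j` at `2g+1` points are
`P j = ε X ^ j`. -/
theorem exists_eq_ite_of_pow_mul_sum_eq (g : ℕ) (a : Fin (2 * g + 1) → K)
    (ha : Function.Injective a) (c : Fin g → Fin g → K)
    (h : ∀ m (j k : Fin g), a m ^ (j : ℕ) * ∑ i, c i k * a m ^ (i : ℕ)
      = a m ^ (k : ℕ) * ∑ i, c i j * a m ^ (i : ℕ)) :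
    ∃ ε : K, ∀ i j, c i j = if i = j then ε else 0 := by
  obtain _ | n := g
  · exact ⟨0, fun i => i.elim0⟩
  let P : Fin (n + 1) → K[X] := fun j => ∑ i : Fin (n + 1), C (c i j) * X ^ (i : ℕ)
  have coeff_P (j i : Fin (n + 1)) : (P j).coeff i = c i j := by
    simp [P, Polynomial.coeff_X_pow, Fin.val_inj]
  have degree_P (j : Fin (n + 1)) : (P j).degree < (n + 1 : ℕ) := by
    refine (Polynomial.degree_sum_le _ _).trans_lt ?_
    refine (Finset.sup_lt_iff (WithBot.bot_lt_coe _)).2 fun i _ => ?_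
    exact (Polynomial.degree_C_mul_X_pow_le _ _).trans_lt (by exact_mod_cast i.2)
  have eval_P (j : Fin (n + 1)) (b : K) : (P j).eval b = ∑ i, c i j * b ^ (i : ℕ) := by
    simp [P, Polynomial.eval_finsetSum]
  have P_eq (j : Fin (n + 1)) : P j = P 0 * X ^ (j : ℕ) := by
    refine Polynomial.eq_of_degrees_lt_of_eval_index_eq Finset.univ ha.injOn ?_ ?_ ?_
    · refine (degree_P j).trans_le ?_
      simp only [Finset.card_univ, Fintype.card_fin]
      exact_mod_cast (by omega)
    · rw [Polynomial.degree_lt_iff_coeff_zero]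
      intro m hm
      simp only [Finset.card_univ, Fintype.card_fin] at hm
      rw [Polynomial.coeff_mul_X_pow']
      split_ifs with hj
      · exact (Polynomial.degree_lt_iff_coeff_zero _ _).1 (degree_P 0) _ (by omega)
      · rfl
    · intro m _
      have := h m 0 j
      simp only [Fin.val_zero, pow_zero, one_mul] at this
      simp [eval_P, this, mul_comm]
  have c_zero (i : Fin (n + 1)) (hi : (i : ℕ) ≠ 0) : c i 0 = 0 := by
    rw [← coeff_P, ← Polynomial.coeff_mul_X_pow (P 0) n i]
    have := P_eq (Fin.last n)
    rw [Fin.val_last] at this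
    rw [← this]
    exact (Polynomial.degree_lt_iff_coeff_zero _ _).1 (degree_P _) _ (by omega)
  refine ⟨c 0 0, fun i j => ?_⟩
  rw [← coeff_P, P_eq, Polynomial.coeff_mul_X_pow']
  split_ifs with hji hij hij
  · subst hij
    simpa using coeff_P 0 0
  · have hne : (i : ℕ) ≠ j := fun e => hij (Fin.ext e)
    have := coeff_P 0 ⟨i - j, by omega⟩
    rw [c_zero _ (by simp only; omega)] at this
    exact this
  · exact absurd (by simp [hij]) hji
  · rfl

theorem ExteriorAlgebra.dual_mul_comm_of_ι_mul_ι_eq_zero {M : Type*} [AddCommGroup M] [Module K M]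
    {x y : M} (h : ExteriorAlgebra.ι K x * ExteriorAlgebra.ι K y = 0) (e f : Module.Dual K M) :
    e x * f y = f x * e y := by
  have := congrArg (fun z => CliffordAlgebra.contractLeft (Q := (0 : QuadraticForm K M)) f
    (CliffordAlgebra.contractLeft (Q := (0 : QuadraticForm K M)) e z)) h
  simp only [ExteriorAlgebra.ι, map_zero] at this
  rw [CliffordAlgebra.contractLeft_ι_mul, CliffordAlgebra.contractLeft_ι, map_sub, map_smul,
    CliffordAlgebra.contractLeft_ι, CliffordAlgebra.contractLeft_mul_algebraMap,
    CliffordAlgebra.contractLeft_ι, Algebra.smul_def, ← map_mul, ← map_mul, ← map_sub] at this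
  have := (ExteriorAlgebra.algebraMap_eq_zero_iff M _).1 this
  exact sub_eq_zero.1 this

theorem Cmap_vv (g : ℕ) (a : K) (i : Fin g) : Cmap g a (vv g i) = a ^ (i : ℕ) • Kvec g a := by
  simp [Cmap, Lfun, vv, Pi.single_apply]

theorem Cmap_ww (g : ℕ) (a : K) (j : Fin g) : Cmap g a (ww g j) = 0 := by
  simp [Cmap, Lfun, ww]

theorem sum_smul_ww_apply_inr (g : ℕ) (u : Fin g → K) (k : Fin g) :
    (∑ j, u j • ww g j : Vg K g) (Sum.inr k) = u k := by
  simp [ww, Finset.sum_apply, Pi.single_apply]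

theorem Kvec_eq_sum (g : ℕ) (a : K) : Kvec g a = ∑ j : Fin g, a ^ (j : ℕ) • ww g j := by
  ext (k | k)
  · simp [Kvec, ww, Finset.sum_apply]
  · rw [sum_smul_ww_apply_inr]
    rfl

/-- A derivation extending `C_a` maps `Σ c_{ij} v_i ∧ w_j` to `K_a ∧ Σ_j (Σ_i c_{ij} a^i) w_j`. -/
theorem derivation_apply_sum (g : ℕ) (a : K)
    (D : ExteriorAlgebra K (Vg K g) →ₗ[K] ExteriorAlgebra K (Vg K g))
    (hD : ∀ x y : Vg K g, D (ExteriorAlgebra.ι K x * ExteriorAlgebra.ι K y)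
      = ExteriorAlgebra.ι K (Cmap g a x) * ExteriorAlgebra.ι K y
        + ExteriorAlgebra.ι K x * ExteriorAlgebra.ι K (Cmap g a y))
    (c : Fin g → Fin g → K) :
    D (∑ i, ∑ j, c i j • (ExteriorAlgebra.ι K (vv g i) * ExteriorAlgebra.ι K (ww g j)))
      = ExteriorAlgebra.ι K (Kvec g a) *
        ExteriorAlgebra.ι K (∑ j, (∑ i, c i j * a ^ (i : ℕ)) • ww g j) := by
  rw [Finset.sum_comm]
  simp only [map_sum, map_smul, hD, Cmap_vv, Cmap_ww, map_zero, mul_zero, add_zero,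
    smul_mul_assoc, Finset.mul_sum, mul_smul_comm, Finset.sum_smul, smul_smul]

/-- an element `x = Σ c_{ij} v_i ∧ w_j` of `V_{1,1}` is killed by all the
derivation extensions `C_{a_m}` on `⋀² V` (for `2g+1` pairwise distinct scalars `a_m`)
iff `x` is a scalar multiple of `δ = Σ_i v_i ∧ w_i`. -/
theorem ker_on_V11 (g : ℕ) (a : Fin (2 * g + 1) → K) (ha : Function.Injective a)
    (D : Fin (2 * g + 1) → (ExteriorAlgebra K (Vg K g) →ₗ[K] ExteriorAlgebra K (Vg K g)))
    (hD : ∀ m, ∀ x y : Vg K g,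
      D m (ExteriorAlgebra.ι K x * ExteriorAlgebra.ι K y)
        = ExteriorAlgebra.ι K (Cmap g (a m) x) * ExteriorAlgebra.ι K y
          + ExteriorAlgebra.ι K x * ExteriorAlgebra.ι K (Cmap g (a m) y))
    (c : Fin g → Fin g → K) :
    (∀ m, D m (∑ i, ∑ j, c i j •
        (ExteriorAlgebra.ι K (vv g i) * ExteriorAlgebra.ι K (ww g j))) = 0)
      ↔ ∃ ε : K,
        (∑ i, ∑ j, c i j •
            (ExteriorAlgebra.ι K (vv g i) * ExteriorAlgebra.ι K (ww g j)))
          = ε • (∑ i, ExteriorAlgebra.ι K (vv g i) * ExteriorAlgebra.ι K (ww g i)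
              : ExteriorAlgebra K (Vg K g)) := by
  constructor
  · intro h
    obtain ⟨ε, hε⟩ := exists_eq_ite_of_pow_mul_sum_eq g a ha c fun m j k => by
      have hm := h m
      rw [derivation_apply_sum g (a m) (D m) (hD m)] at hm
      have := ExteriorAlgebra.dual_mul_comm_of_ι_mul_ι_eq_zero hm
        (LinearMap.proj (Sum.inr j)) (LinearMap.proj (Sum.inr k))
      simp only [LinearMap.proj_apply, sum_smul_ww_apply_inr] at this
      exact this
    refine ⟨ε, ?_⟩
    simp [hε, Finset.smul_sum, ite_smul]
  · rintro ⟨ε, hε⟩ m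
    have hδ : (∑ i, ExteriorAlgebra.ι K (vv g i) * ExteriorAlgebra.ι K (ww g i)
        : ExteriorAlgebra K (Vg K g)) = ∑ i, ∑ j, (if i = j then (1 : K) else 0) •
          (ExteriorAlgebra.ι K (vv g i) * ExteriorAlgebra.ι K (ww g j)) := by
      simp [ite_smul]
    rw [hε, map_smul, hδ, derivation_apply_sum g (a m) (D m) (hD m)]
    simp [← Kvec_eq_sum]
end
end

section
/- With the same setup, if y = Σ_{1≤i<j≤g} c_{ij} v_i ∧ v_j ∈ V_{2,0} = span{v_i ∧ v_j} satisfies C_{a_m}(y) = 0 for 2g+1 pairwise distinct scalars a_1,…,a_{2g+1}, then y = 0. -/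
noncomputable section

variable {K : Type*} [Field K]

open ExteriorAlgebra in
/-- A combination of products `ι (v i) * ι (v j)` with symmetric coefficients vanishes, in every
characteristic. -/
theorem sum_smul_ι_mul_ι_eq_zero_of_symm {R M I : Type*} [CommRing R] [AddCommGroup M]
    [Module R M] [Fintype I] (v : I → M) (c : I × I → R) (hc : ∀ p, c p = c p.swap) :
    ∑ p, c p • (ι R (v p.1) * ι R (v p.2)) = 0 := by
  refine Finset.sum_involution (fun p _ => p.swap) (fun p _ => ?_) (fun p _ hp hswap => hp ?_)
    (fun _ _ => Finset.mem_univ _) (fun p _ => p.swap_swap)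
  · rw [← hc p, ← smul_add, Prod.fst_swap, Prod.snd_swap, ι_add_mul_swap, smul_zero]
  · have : p.2 = p.1 := congrArg Prod.fst hswap
    rw [this, ι_sq_zero, smul_zero]

theorem Lfun_vv (g : ℕ) (a : K) (i : Fin g) : Lfun g a (vv g i) = a ^ (i : ℕ) := by
  simp [Lfun, vv, Pi.single_apply]

open CliffordAlgebra in
/-- Contracting the derivation extension of `C_a` on `v_i ∧ v_j` with the coordinate of the first
`w` gives `a ^ i • v_j - a ^ j • v_i`. -/
theorem contractLeft_Cmap_vv (g : ℕ) (a : K) (i j k : Fin g) (hk : (k : ℕ) = 0) :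
    contractLeft (Q := (0 : QuadraticForm K (Vg K g)))
      (LinearMap.proj (Sum.inr k) : Module.Dual K (Vg K g))
      (ExteriorAlgebra.ι K (Cmap g a (vv g i)) * ExteriorAlgebra.ι K (vv g j)
        + ExteriorAlgebra.ι K (vv g i) * ExteriorAlgebra.ι K (Cmap g a (vv g j)))
      = ExteriorAlgebra.ι K (a ^ (i : ℕ) • vv g j - a ^ (j : ℕ) • vv g i) := by
  have hv (l : Fin g) : (vv g l : Vg K g) (Sum.inr k) = 0 := by simp [vv]
  have hC (l : Fin g) : Cmap g a (vv g l) (Sum.inr k) = a ^ (l : ℕ) := by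
    simp [Cmap, Lfun_vv, Kvec, hk]
  rw [map_add]
  erw [contractLeft_ι_mul, contractLeft_ι_mul, contractLeft_ι, contractLeft_ι]
  simp only [LinearMap.proj_apply, hv, hC, map_zero, mul_zero, zero_smul, sub_zero, zero_sub,
    map_sub, map_smul]
  rw [← Algebra.commutes, ← Algebra.smul_def, sub_eq_add_neg]

/-- if `y ∈ V_{2,0} = span{v_i ∧ v_j}` is killed by the derivation
extensions of `C_{a_m}` on `⋀² V` for `2g+1` pairwise distinct scalars `a_m`,
then `y = 0`. -/
theorem ker_on_V20 (g : ℕ) (a : Fin (2 * g + 1) → K) (ha : Function.Injective a)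
    (D : Fin (2 * g + 1) → (ExteriorAlgebra K (Vg K g) →ₗ[K] ExteriorAlgebra K (Vg K g)))
    (hD : ∀ m, ∀ x y : Vg K g,
      D m (ExteriorAlgebra.ι K x * ExteriorAlgebra.ι K y)
        = ExteriorAlgebra.ι K (Cmap g (a m) x) * ExteriorAlgebra.ι K y
          + ExteriorAlgebra.ι K x * ExteriorAlgebra.ι K (Cmap g (a m) y))
    (y : ExteriorAlgebra K (Vg K g))
    (hy : y ∈ Submodule.span K
      {x : ExteriorAlgebra K (Vg K g) | ∃ i j : Fin g,
        x = ExteriorAlgebra.ι K (vv g i) * ExteriorAlgebra.ι K (vv g j)})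
    (h0 : ∀ m, D m y = 0) :
    y = 0 := by
  have hset : {x : ExteriorAlgebra K (Vg K g) | ∃ i j : Fin g,
      x = ExteriorAlgebra.ι K (vv g i) * ExteriorAlgebra.ι K (vv g j)}
      = Set.range fun p : Fin g × Fin g =>
        ExteriorAlgebra.ι K (vv g p.1) * ExteriorAlgebra.ι K (vv g p.2) := by
    ext x
    simp [eq_comm]
  rw [hset, Submodule.mem_span_range_iff_exists_fun] at hy
  obtain ⟨c, rfl⟩ := hy
  refine sum_smul_ι_mul_ι_eq_zero_of_symm _ c fun ⟨i, j⟩ => sub_eq_zero.mp ?_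
  let k : Fin g := ⟨0, i.pos⟩
  have hcontract (m : Fin (2 * g + 1)) :
      ∑ p : Fin g × Fin g, c p • (a m ^ (p.1 : ℕ) • vv g p.2 - a m ^ (p.2 : ℕ) • vv g p.1)
        = (0 : Vg K g) := by
    apply (ExteriorAlgebra.ι_leftInverse (R := K) (M := Vg K g)).injective
    have h := congrArg (CliffordAlgebra.contractLeft (Q := (0 : QuadraticForm K (Vg K g)))
      (LinearMap.proj (Sum.inr k) : Module.Dual K (Vg K g))) (h0 m)
    simp only [map_sum, map_smul, hD] at h
    rw [map_zero, map_sum, ← map_zero (CliffordAlgebra.contractLeft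
      (Q := (0 : QuadraticForm K (Vg K g)))
      (LinearMap.proj (Sum.inr k) : Module.Dual K (Vg K g))), ← h]
    refine Finset.sum_congr rfl fun p _ => ?_
    rw [map_smul, ← contractLeft_Cmap_vv g (a m) p.1 p.2 k rfl]
  have hroot (m : Fin (2 * g + 1)) :
      ∑ l : Fin g, (c (l, j) - c (j, l)) * a m ^ (l : ℕ) = 0 := by
    have h := congrFun (hcontract m) (Sum.inl j)
    simpa [Fintype.sum_prod_type, vv, Pi.single_apply, mul_sub, sub_mul,
      Finset.sum_sub_distrib] using h
  have hle : g ≤ 2 * g + 1 := by omega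
  have hzero := Matrix.eq_zero_of_forall_index_sum_mul_pow_eq_zero
    (f := fun m : Fin g => a (Fin.castLE hle m)) (v := fun l => c (l, j) - c (j, l))
    (ha.comp (Fin.castLE_injective hle)) fun m => hroot _
  exact congrFun hzero i
end
end

section
/- The 2g−2 elements α_k, β_k (k = 1,…,g−1) defined by α_k = Σ_{a≤k<b} v_{a+b−k−1}∧w_a∧w_b and β_k = Σ_{a≤k<b} v_{a+b−k}∧w_a∧w_b are linearly independent in ⋀^3 V for g ≥ 2. -/
noncomputable section

variable {K : Type*} [Field K]

/-- `v_s`, 1-based, `v_s = 0` if `s ∉ {1,…,g}`. -/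
def vext (g : ℕ) (s : ℕ) : Vg K g :=
  if h : 1 ≤ s ∧ s ≤ g then vv g ⟨s - 1, by omega⟩ else 0

/-- `w_s`, 1-based, `w_s = 0` if `s ∉ {1,…,g}`. -/
def wext (g : ℕ) (s : ℕ) : Vg K g :=
  if h : 1 ≤ s ∧ s ≤ g then ww g ⟨s - 1, by omega⟩ else 0

/-- `α_k = Σ_{a≤k<b≤g} v_{a+b−k−1} ∧ w_a ∧ w_b` -/
def alphaE (g k : ℕ) : ExteriorAlgebra K (Vg K g) :=
  ∑ a ∈ Finset.Icc 1 k, ∑ b ∈ Finset.Icc (k + 1) g,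
    ExteriorAlgebra.ι K (vext g (a + b - k - 1)) * ExteriorAlgebra.ι K (wext g a)
      * ExteriorAlgebra.ι K (wext g b)

/-- `β_k = Σ_{a≤k<b≤g} v_{a+b−k} ∧ w_a ∧ w_b` -/
def betaE (g k : ℕ) : ExteriorAlgebra K (Vg K g) :=
  ∑ a ∈ Finset.Icc 1 k, ∑ b ∈ Finset.Icc (k + 1) g,
    ExteriorAlgebra.ι K (vext g (a + b - k)) * ExteriorAlgebra.ι K (wext g a)
      * ExteriorAlgebra.ι K (wext g b)

/-- The linear functional on the exterior algebra that vanishes outside degree three and reads off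
the coefficient of `v_{s+1} ∧ w_{a+1} ∧ w_{b+1}` in degree three. -/
def vwwCoeff (g : ℕ) (s a b : Fin g) : ExteriorAlgebra K (Vg K g) →ₗ[K] K :=
  ExteriorAlgebra.liftAlternating (Pi.single 3
    ((Matrix.detRowAlternating (n := Fin 3) (R := K)).compLinearMap
      (LinearMap.pi ![LinearMap.proj (Sum.inl s), LinearMap.proj (Sum.inr a),
        LinearMap.proj (Sum.inr b)])))

theorem vext_apply_inl (g n : ℕ) (s : Fin g) :
    vext (K := K) g n (Sum.inl s) = if n = s + 1 then 1 else 0 := by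
  have := s.2
  unfold vext vv
  split_ifs with h h' h' <;> simp [Pi.single_apply, Fin.ext_iff] <;> omega

theorem vext_apply_inr (g n : ℕ) (s : Fin g) : vext (K := K) g n (Sum.inr s) = 0 := by
  unfold vext vv
  split_ifs <;> simp

theorem wext_apply_inr (g n : ℕ) (s : Fin g) :
    wext (K := K) g n (Sum.inr s) = if n = s + 1 then 1 else 0 := by
  have := s.2
  unfold wext ww
  split_ifs with h h' h' <;> simp [Pi.single_apply, Fin.ext_iff] <;> omega

theorem wext_apply_inl (g n : ℕ) (s : Fin g) : wext (K := K) g n (Sum.inl s) = 0 := by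
  unfold wext ww
  split_ifs <;> simp

theorem vwwCoeff_ι_mul_ι_mul_ι (g : ℕ) (s a b : Fin g) (x y z : Vg K g) :
    vwwCoeff g s a b (ExteriorAlgebra.ι K x * ExteriorAlgebra.ι K y * ExteriorAlgebra.ι K z) =
      Matrix.det !![x (.inl s), x (.inr a), x (.inr b); y (.inl s), y (.inr a), y (.inr b);
        z (.inl s), z (.inr a), z (.inr b)] := by
  have h : ExteriorAlgebra.ι K x * ExteriorAlgebra.ι K y * ExteriorAlgebra.ι K z =
      ExteriorAlgebra.ιMulti K 3 ![x, y, z] := by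
    simp [ExteriorAlgebra.ιMulti_apply, mul_assoc]
  rw [h, vwwCoeff, ExteriorAlgebra.liftAlternating_apply_ιMulti, Pi.single_eq_same,
    AlternatingMap.compLinearMap_apply]
  change Matrix.det _ = _
  congr 1
  ext i j
  fin_cases i <;> fin_cases j <;> rfl

theorem vwwCoeff_vext_wext_wext (g n m l : ℕ) (s a b : Fin g) (hab : a < b) (hml : m < l) :
    vwwCoeff g s a b (ExteriorAlgebra.ι K (vext g n) * ExteriorAlgebra.ι K (wext g m) *
      ExteriorAlgebra.ι K (wext g l)) =
      if m = a + 1 then if l = b + 1 then if n = s + 1 then 1 else 0 else 0 else 0 := by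
  rw [vwwCoeff_ι_mul_ι_mul_ι, Matrix.det_fin_three]
  have : (a : ℕ) < b := hab
  simp only [vext_apply_inl, vext_apply_inr, wext_apply_inl, wext_apply_inr, Matrix.of_apply,
    Matrix.cons_val]
  split_ifs <;> first | omega | simp

/-- A triple coefficient of a sum `∑_{i ≤ k < j} v_{f i j} ∧ w_i ∧ w_j`. -/
theorem vwwCoeff_sum (g k : ℕ) (f : ℕ → ℕ → ℕ) (s a b : Fin g) (hab : a < b) :
    vwwCoeff g s a b (∑ i ∈ Finset.Icc 1 k, ∑ j ∈ Finset.Icc (k + 1) g,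
      ExteriorAlgebra.ι K (vext g (f i j)) * ExteriorAlgebra.ι K (wext g i) *
        ExteriorAlgebra.ι K (wext g j)) =
      if (a : ℕ) + 1 ≤ k ∧ k ≤ b ∧ f (a + 1) (b + 1) = s + 1 then 1 else 0 := by
  have hb := b.2
  simp only [map_sum]
  rw [Finset.sum_congr rfl fun i hi => Finset.sum_congr rfl fun j hj =>
    vwwCoeff_vext_wext_wext g (f i j) i j s a b hab
      (by rw [Finset.mem_Icc] at hi hj; omega)]
  rw [Finset.sum_congr rfl fun i _ => (Finset.sum_ite_irrel _ _ _ _)]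
  simp only [Finset.sum_const_zero, Finset.sum_ite_eq', Finset.mem_Icc]
  split_ifs <;> first | rfl | omega

/-- the `2g−2` elements `α_k, β_k` (`k = 1,…,g−1`) are linearly
independent in `⋀³ V` for `g ≥ 2`. -/
theorem alpha_beta_linearIndependent (g : ℕ) (hg : 2 ≤ g) :
    LinearIndependent K
      (Sum.elim (fun k : Fin (g - 1) => alphaE (K := K) g (k.1 + 1))
        (fun k : Fin (g - 1) => betaE (K := K) g (k.1 + 1))) := by
  have hα (k : ℕ) (s a b : Fin g) (hab : a < b) := vwwCoeff_sum (K := K) g k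
    (fun i j => i + j - k - 1) s a b hab
  have hβ (k : ℕ) (s a b : Fin g) (hab : a < b) := vwwCoeff_sum (K := K) g k
    (fun i j => i + j - k) s a b hab
  refine LinearIndependent.of_pairwise_dual_eq_zero_one _
    (Sum.elim
      (fun k => vwwCoeff g ⟨0, by omega⟩ ⟨0, by omega⟩ ⟨k + 1, by omega⟩)
      (fun k => vwwCoeff g ⟨k + 1, by omega⟩ ⟨k, by omega⟩ ⟨k + 1, by omega⟩)) ?_ ?_
  · rintro (k | k) (l | l) hkl <;>
      simp only [ne_eq, Sum.inl.injEq, Sum.inr.injEq, Fin.ext_iff] at hkl <;>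
      simp only [Sum.elim_inl, Sum.elim_inr, alphaE, betaE]
    all_goals
      first
      | rw [hα _ _ _ _ (by simp [Fin.lt_def])]
      | rw [hβ _ _ _ _ (by simp [Fin.lt_def])]
      exact if_neg (by dsimp only; omega)
  · rintro (k | k) <;> simp only [Sum.elim_inl, Sum.elim_inr, alphaE, betaE]
    all_goals
      first
      | rw [hα _ _ _ _ (by simp [Fin.lt_def])]
      | rw [hβ _ _ _ _ (by simp [Fin.lt_def])]
      exact if_pos (by dsimp only; omega)
end
end

section
/- Let V have basis v1,…,vg,w1,…,wg and let C_a be the derivation on ⋀^3 V with C_a(v_i) = a^{p(i−1)} K_a where K_a = Σ_k a^{p(k−1)} w_k and C_a(w_j) = 0. Suppose α = Σ_{1≤a<b≤g, 1≤c≤g} d_{a,b;c} v_a∧v_b∧w_c lies in ⋂ ker C_{a_m} for sufficiently many scalars with distinct p-th powers. Then the coefficients satisfy d_{s−k,i;j} − d_{i,s−k;j} + d_{i,s−j;k} − d_{s−j,i;k} = 0 for all parameters s,k,i,j with j < k (with coefficients with out-of-range or non-increasing indices set to 0), and consequently α = 0. -/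
noncomputable section

variable {K : Type*} [Field K]

/-- The element `α = Σ d_{a,b;c} v_a ∧ v_b ∧ w_c` of `V_{2,1}` (1-based indices,
out-of-range coefficients being zero). -/
def alphaV21 (g : ℕ) (d : ℕ → ℕ → ℕ → K) : ExteriorAlgebra K (Vg K g) :=
  ∑ a ∈ Finset.Icc 1 g, ∑ b ∈ Finset.Icc 1 g, ∑ c ∈ Finset.Icc 1 g,
    d a b c • (ExteriorAlgebra.ι K (vext g a) * ExteriorAlgebra.ι K (vext g b)
      * ExteriorAlgebra.ι K (wext g c))

/-- The determinant of three coordinates, as a linear functional on the exterior algebra. -/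
def wedgeCoord {g : ℕ} (f : Fin 3 → Fin g ⊕ Fin g) : ExteriorAlgebra K (Vg K g) →ₗ[K] K :=
  ExteriorAlgebra.liftAlternating (Pi.single 3
    ((Matrix.detRowAlternating (R := K) (n := Fin 3)).compLinearMap
      (LinearMap.funLeft K K f)))

lemma wedgeCoord_ι_mul_ι_mul_ι {g : ℕ} (f : Fin 3 → Fin g ⊕ Fin g) (x y z : Vg K g) :
    wedgeCoord f (ExteriorAlgebra.ι K x * ExteriorAlgebra.ι K y * ExteriorAlgebra.ι K z)
      = x (f 0) * y (f 1) * z (f 2) - x (f 0) * y (f 2) * z (f 1)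
        - x (f 1) * y (f 0) * z (f 2) + x (f 1) * y (f 2) * z (f 0)
        + x (f 2) * y (f 0) * z (f 1) - x (f 2) * y (f 1) * z (f 0) := by
  have h : ExteriorAlgebra.ι K x * ExteriorAlgebra.ι K y * ExteriorAlgebra.ι K z
      = ExteriorAlgebra.ιMulti K 3 ![x, y, z] := by
    simp [ExteriorAlgebra.ιMulti_apply, mul_assoc]
  rw [h, wedgeCoord, ExteriorAlgebra.liftAlternating_apply_ιMulti, Pi.single_eq_same,
    AlternatingMap.compLinearMap_apply]
  refine (Matrix.det_fin_three (Matrix.of fun r => LinearMap.funLeft K K f (![x, y, z] r))).trans ?_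
  simp [LinearMap.funLeft_apply]

lemma vext_inl {g : ℕ} (a : ℕ) (i : Fin g) :
    (vext g a : Vg K g) (Sum.inl i) = if a = i + 1 then 1 else 0 := by
  have := i.2
  unfold vext vv
  split_ifs with h h' h'
  · subst h'
    simp
  · rw [Pi.single_eq_of_ne]
    simp only [ne_eq, Sum.inl.injEq, Fin.ext_iff]
    omega
  · omega
  · rfl

lemma vext_inr {g : ℕ} (a : ℕ) (i : Fin g) : (vext g a : Vg K g) (Sum.inr i) = 0 := by
  unfold vext vv
  split_ifs <;> simp

lemma wext_inl {g : ℕ} (a : ℕ) (i : Fin g) : (wext g a : Vg K g) (Sum.inl i) = 0 := by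
  unfold wext ww
  split_ifs <;> simp

lemma wext_inr {g : ℕ} (a : ℕ) (i : Fin g) :
    (wext g a : Vg K g) (Sum.inr i) = if a = i + 1 then 1 else 0 := by
  have := i.2
  unfold wext ww
  split_ifs with h h' h'
  · subst h'
    simp
  · rw [Pi.single_eq_of_ne]
    simp only [ne_eq, Sum.inr.injEq, Fin.ext_iff]
    omega
  · omega
  · rfl

lemma Lfun_vext {g : ℕ} (x : K) {a : ℕ} (ha : a ∈ Finset.Icc 1 g) :
    Lfun g x (vext g a) = x ^ (a - 1) := by
  obtain ⟨h1, h2⟩ := Finset.mem_Icc.1 ha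
  simp only [Lfun, LinearMap.sum_apply, LinearMap.smul_apply, LinearMap.proj_apply, vext_inl,
    smul_eq_mul, mul_ite, mul_one, mul_zero]
  rw [Finset.sum_eq_single (⟨a - 1, by omega⟩ : Fin g)]
  · rw [if_pos (by simp only; omega)]
  · intro b _ hb
    rw [if_neg]
    intro h
    apply hb
    simp only [Fin.ext_iff]
    omega
  · simp

lemma Lfun_wext {g : ℕ} (x : K) (a : ℕ) : Lfun g x (wext g a) = 0 := by
  simp [Lfun, wext_inl]

/-- The `v_i ∧ w_k ∧ w_j`-coordinate of the image of `v_a ∧ v_b ∧ w_c` under the derivation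
extending `Cmap g x`. -/
lemma wedgeCoord_derivation {g : ℕ} (x : K) (i j k : Fin g) {a b : ℕ}
    (ha : a ∈ Finset.Icc 1 g) (hb : b ∈ Finset.Icc 1 g) (c : ℕ) :
    wedgeCoord ![Sum.inl i, Sum.inr k, Sum.inr j]
      (ExteriorAlgebra.ι K (Cmap g x (vext g a)) * ExteriorAlgebra.ι K (vext g b)
            * ExteriorAlgebra.ι K (wext g c)
          + ExteriorAlgebra.ι K (vext g a) * ExteriorAlgebra.ι K (Cmap g x (vext g b))
            * ExteriorAlgebra.ι K (wext g c)
          + ExteriorAlgebra.ι K (vext g a) * ExteriorAlgebra.ι K (vext g b)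
            * ExteriorAlgebra.ι K (Cmap g x (wext g c)))
      = ((if a = i + 1 then x ^ (b - 1) else 0) - (if b = i + 1 then x ^ (a - 1) else 0))
        * ((if c = j + 1 then x ^ (k : ℕ) else 0) - (if c = k + 1 then x ^ (j : ℕ) else 0)) := by
  simp only [map_add, wedgeCoord_ι_mul_ι_mul_ι, Cmap, LinearMap.smulRight_apply, Lfun_vext x ha,
    Lfun_vext x hb, Lfun_wext, Pi.smul_apply, smul_eq_mul, Kvec, Matrix.cons_val_zero,
    Matrix.cons_val_one, Matrix.cons_val, vext_inl, vext_inr, wext_inl, wext_inr, Sum.elim_inl,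
    Sum.elim_inr]
  split_ifs <;> ring

/-- The `v_i ∧ w_k ∧ w_j`-coordinate of the vanishing of the derivation on `alphaV21 g d`. -/
lemma sum_eq_zero_of_derivation_alphaV21 {g : ℕ} (x : K) (d : ℕ → ℕ → ℕ → K)
    (D : ExteriorAlgebra K (Vg K g) →ₗ[K] ExteriorAlgebra K (Vg K g))
    (hD : ∀ u v w : Vg K g,
      D (ExteriorAlgebra.ι K u * ExteriorAlgebra.ι K v * ExteriorAlgebra.ι K w)
        = ExteriorAlgebra.ι K (Cmap g x u) * ExteriorAlgebra.ι K v * ExteriorAlgebra.ι K w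
          + ExteriorAlgebra.ι K u * ExteriorAlgebra.ι K (Cmap g x v) * ExteriorAlgebra.ι K w
          + ExteriorAlgebra.ι K u * ExteriorAlgebra.ι K v * ExteriorAlgebra.ι K (Cmap g x w))
    (hker : D (alphaV21 g d) = 0) {i j k : ℕ} (hi : i ∈ Finset.Icc 1 g)
    (hj : j ∈ Finset.Icc 1 g) (hk : k ∈ Finset.Icc 1 g) :
    ∑ a ∈ Finset.Icc 1 g, ((d a i j - d i a j) * x ^ (a + k)
      - (d a i k - d i a k) * x ^ (a + j)) = 0 := by
  have hi' := Finset.mem_Icc.1 hi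
  have hj' := Finset.mem_Icc.1 hj
  have hk' := Finset.mem_Icc.1 hk
  have h := congrArg (wedgeCoord (![Sum.inl ⟨i - 1, by omega⟩, Sum.inr ⟨k - 1, by omega⟩,
    Sum.inr ⟨j - 1, by omega⟩] : Fin 3 → Fin g ⊕ Fin g)) hker
  simp only [alphaV21, map_sum, map_smul, hD, map_zero, smul_eq_mul] at h
  have hsum : ∑ a ∈ Finset.Icc 1 g, ∑ b ∈ Finset.Icc 1 g, ∑ c ∈ Finset.Icc 1 g,
      d a b c * (((if a = i then x ^ (b - 1) else 0) - (if b = i then x ^ (a - 1) else 0))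
        * ((if c = j then x ^ (k - 1) else 0) - (if c = k then x ^ (j - 1) else 0))) = 0 := by
    refine Eq.trans (Finset.sum_congr rfl fun a ha => Finset.sum_congr rfl fun b hb =>
      Finset.sum_congr rfl fun c _ => ?_) h
    rw [wedgeCoord_derivation x _ _ _ ha hb]
    simp only [Nat.sub_add_cancel hi'.1, Nat.sub_add_cancel hj'.1, Nat.sub_add_cancel hk'.1]
  simp only [sub_mul, mul_sub, ite_mul, mul_ite, zero_mul, mul_zero, Finset.sum_sub_distrib,
    Finset.sum_ite_eq', Finset.sum_ite_irrel, Finset.sum_const_zero, hi, hj, hk,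
    if_true] at hsum
  have hmul := congrArg (fun t => - (x ^ 2 * t)) hsum
  simp only [mul_zero, neg_zero] at hmul
  rw [← hmul]
  simp only [← Finset.sum_sub_distrib, Finset.mul_sum, ← Finset.sum_neg_distrib]
  refine Finset.sum_congr rfl fun a ha => ?_
  obtain ⟨a, rfl⟩ := Nat.exists_eq_add_of_le' (Finset.mem_Icc.1 ha).1
  obtain ⟨j, rfl⟩ := Nat.exists_eq_add_of_le' hj'.1
  obtain ⟨k, rfl⟩ := Nat.exists_eq_add_of_le' hk'.1
  simp only [Nat.add_sub_cancel]
  ring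

/-- Coefficient comparison for a difference of two shifted polynomials vanishing at more than
`2 * g` points. -/
lemma coeff_eq_of_sum_eq_zero {g : ℕ} (x : Fin (2 * g + 1) → K) (hx : Function.Injective x)
    (e f : ℕ → K) (he : ∀ a ∉ Finset.Icc 1 g, e a = 0) (hf : ∀ a ∉ Finset.Icc 1 g, f a = 0)
    {j k : ℕ} (hj : j ≤ g) (hk : k ≤ g)
    (h : ∀ m, ∑ a ∈ Finset.Icc 1 g, (e a * x m ^ (a + k) - f a * x m ^ (a + j)) = 0) (s : ℕ) :
    e (s - k) = f (s - j) := by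
  open Polynomial in
  have coeff_shift : ∀ (u : ℕ → K) (l : ℕ), (∀ a ∉ Finset.Icc 1 g, u a = 0) →
      (∑ a ∈ Finset.Icc 1 g, C (u a) * X ^ (a + l)).coeff s = u (s - l) := by
    intro u l hu
    simp only [finsetSum_coeff, coeff_C_mul_X_pow]
    by_cases hs : s - l ∈ Finset.Icc 1 g
    · have h1 := (Finset.mem_Icc.1 hs).1
      rw [Finset.sum_eq_single_of_mem _ hs, if_pos (by omega)]
      intro b _ hb
      exact if_neg (by omega)
    · rw [hu _ hs]
      refine Finset.sum_eq_zero fun a ha => if_neg ?_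
      rintro rfl
      exact hs (by simpa using ha)
  open Polynomial in
  have hP : ∑ a ∈ Finset.Icc 1 g, C (e a) * X ^ (a + k)
      - ∑ a ∈ Finset.Icc 1 g, C (f a) * X ^ (a + j) = 0 := by
    have natDegree_shift : ∀ (u : ℕ → K) (l : ℕ), l ≤ g →
        (∑ a ∈ Finset.Icc 1 g, C (u a) * X ^ (a + l)).natDegree ≤ 2 * g := by
      intro u l hl
      refine natDegree_sum_le_of_forall_le _ _ fun a ha => ?_
      have := (Finset.mem_Icc.1 ha).2
      exact (natDegree_C_mul_X_pow_le _ _).trans (by omega)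
    refine eq_zero_of_natDegree_lt_card_of_eval_eq_zero _ hx (fun m => ?_) ?_
    · simpa [eval_finsetSum] using h m
    · rw [Fintype.card_fin]
      exact Nat.lt_succ_of_le
        ((natDegree_sub_le_of_le (natDegree_shift e k hk) (natDegree_shift f j hj)).trans
          (max_self _).le)
  have hs := congrArg (Polynomial.coeff · s) hP
  simp only [Polynomial.coeff_sub, Polynomial.coeff_zero, coeff_shift e k he,
    coeff_shift f j hf] at hs
  exact sub_eq_zero.1 hs

/-- A family of zero-extended Toeplitz matrices `a, c ↦ e a i c` with `e i i i = 0` vanishes. -/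
lemma eq_zero_of_toeplitz {g : ℕ} (e : ℕ → ℕ → ℕ → K)
    (he : ∀ a i c, a ∉ Finset.Icc 1 g → e a i c = 0) (hdiag : ∀ i, e i i i = 0)
    (h : ∀ i ∈ Finset.Icc 1 g, ∀ j ∈ Finset.Icc 1 g, ∀ k ∈ Finset.Icc 1 g, ∀ s,
      e (s - k) i j = e (s - j) i k)
    {a i c : ℕ} (hi : i ∈ Finset.Icc 1 g) (hc : c ∈ Finset.Icc 1 g) : e a i c = 0 := by
  have hc' := Finset.mem_Icc.1 hc
  rcases lt_trichotomy a c with hac | rfl | hac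
  · have := h i hi c hc 1 (by simp; omega) (a + 1)
    rw [Nat.add_sub_cancel] at this
    rw [this]
    exact he _ _ _ (by simp only [Finset.mem_Icc]; omega)
  · have := h i hi a hc i hi (a + i)
    rwa [Nat.add_sub_cancel, Nat.add_sub_cancel_left, hdiag] at this
  · have := h i hi c hc g (by simp; omega) (a + g)
    rw [Nat.add_sub_cancel] at this
    rw [this]
    exact he _ _ _ (by simp only [Finset.mem_Icc]; omega)

/-- suppose `g ≥ 3` and `α = Σ_{a<b,c} d_{a,b;c} v_a∧v_b∧w_c ∈ V_{2,1}`
lies in the intersection of the kernels of the derivation extensions to `⋀³V` of the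
operators `C` with parameters `(a_m)^p`, `m = 1,…,2g+1`, having pairwise distinct
`p`-th powers (so `C(v_i) = a_m^{p(i−1)} K_{a_m^p}`, `C(w_j) = 0`).  Then the
coefficients satisfy `d_{s−k,i;j} − d_{i,s−k;j} + d_{i,s−j;k} − d_{s−j,i;k} = 0` for all
`s,k,i,j` with `j < k`, and consequently `α = 0`. -/
theorem ker_on_V21 (g : ℕ) (hg : 3 ≤ g) (p : ℕ) (hp : 0 < p)
    (aa : Fin (2 * g + 1) → K) (ha : Function.Injective fun m => (aa m) ^ p)
    (d : ℕ → ℕ → ℕ → K)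
    (hd0 : ∀ a b c : ℕ, ¬(1 ≤ a ∧ a < b ∧ b ≤ g ∧ 1 ≤ c ∧ c ≤ g) → d a b c = 0)
    (D : Fin (2 * g + 1) →
      (ExteriorAlgebra K (Vg K g) →ₗ[K] ExteriorAlgebra K (Vg K g)))
    (hD : ∀ m, ∀ x y z : Vg K g,
      D m (ExteriorAlgebra.ι K x * ExteriorAlgebra.ι K y * ExteriorAlgebra.ι K z)
        = ExteriorAlgebra.ι K (Cmap g ((aa m) ^ p) x) * ExteriorAlgebra.ι K y
            * ExteriorAlgebra.ι K z
          + ExteriorAlgebra.ι K x * ExteriorAlgebra.ι K (Cmap g ((aa m) ^ p) y)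
            * ExteriorAlgebra.ι K z
          + ExteriorAlgebra.ι K x * ExteriorAlgebra.ι K y
            * ExteriorAlgebra.ι K (Cmap g ((aa m) ^ p) z))
    (hker : ∀ m, D m (alphaV21 g d) = 0) :
    (∀ s k i j : ℕ, j < k →
        d (s - k) i j - d i (s - k) j + d i (s - j) k - d (s - j) i k = 0)
    ∧ alphaV21 g d = 0 := by
  have hout : ∀ a i c, a ∉ Finset.Icc 1 g → d a i c - d i a c = 0 := by
    intro a i c ha
    rw [Finset.mem_Icc] at ha
    rw [hd0 a i c (by omega), hd0 i a c (by omega), sub_zero]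
  have hskew : ∀ a i c, i ∈ Finset.Icc 1 g → c ∈ Finset.Icc 1 g → d a i c - d i a c = 0 := by
    intro a i c hi hc
    refine eq_zero_of_toeplitz (g := g) (fun a i c => d a i c - d i a c) hout
      (fun i => sub_self _) (fun i hi j hj k hk s => ?_) hi hc
    exact coeff_eq_of_sum_eq_zero (fun m => aa m ^ p) ha (fun a => d a i j - d i a j)
      (fun a => d a i k - d i a k) (fun a => hout a i j) (fun a => hout a i k)
      (Finset.mem_Icc.1 hj).2 (Finset.mem_Icc.1 hk).2
      (fun m => sum_eq_zero_of_derivation_alphaV21 _ d (D m) (hD m) (hker m) hi hj hk) s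
  have hd : ∀ a b c, d a b c = 0 := by
    intro a b c
    by_cases h : 1 ≤ a ∧ a < b ∧ b ≤ g ∧ 1 ≤ c ∧ c ≤ g
    · have := hskew a b c (Finset.mem_Icc.2 (by omega)) (Finset.mem_Icc.2 (by omega))
      rwa [hd0 b a c (by omega), sub_zero] at this
    · exact hd0 a b c h
  exact ⟨by simp [hd], by simp [alphaV21, hd]⟩
end
end

section
/- Let V have basis v1,…,vg,w1,…,wg over a field containing at least g pairwise distinct scalars a1,…,ag, with coordinate functionals L_a = Σ_k a^{k−1}x_k and vectors K_a = Σ_k a^{k−1}w_k, and let C_a be the derivation on ⋀^r V with C_a(v) = L_a(v)K_a. If ω = Σ c_{i1,…,ir} v_{i1}∧⋯∧v_{ir} lies in ⋀^r(span{v1,…,vg}) and C_{a_m}(ω) = 0 for m = 1,…,g, then ω = 0. -/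
noncomputable section

variable {K : Type*} [Field K]

/-- `D` is the derivation extension of `C_a` on `⋀^r V`:
`D(u₁∧⋯∧u_r) = Σ_i u₁∧⋯∧C_a(u_i)∧⋯∧u_r`. -/
def IsDerivExt (g : ℕ) (a : K) (r : ℕ)
    (D : ExteriorAlgebra K (Vg K g) →ₗ[K] ExteriorAlgebra K (Vg K g)) : Prop :=
  ∀ u : Fin r → Vg K g,
    D (List.ofFn fun j => ExteriorAlgebra.ι K (u j)).prod
      = ∑ i : Fin r,
          (List.ofFn fun j =>
            ExteriorAlgebra.ι K (Function.update u i (Cmap g a (u i)) j)).prod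

open CliffordAlgebra in
theorem exterior_contractLeft_ι_mul {M : Type*} [AddCommGroup M] [Module K M]
    (L : Module.Dual K M) (u : M) (x : ExteriorAlgebra K M) :
    contractLeft (Q := (0 : QuadraticForm K M)) L (ExteriorAlgebra.ι K u * x)
      = L u • x - ExteriorAlgebra.ι K u * contractLeft (Q := (0 : QuadraticForm K M)) L x :=
  contractLeft_ι_mul L u x

open CliffordAlgebra in
/-- The derivation extending `x ↦ L x • k` is contraction by `L` followed by left multiplication
by `k`. -/
theorem sum_prod_update_smulRight {M : Type*} [AddCommGroup M] [Module K M]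
    (L : Module.Dual K M) (k : M) (r : ℕ) (u : Fin r → M) :
    ∑ i : Fin r, (List.ofFn fun j =>
        ExteriorAlgebra.ι K (Function.update u i (L.smulRight k (u i)) j)).prod
      = ExteriorAlgebra.ι K k *
        contractLeft (Q := (0 : QuadraticForm K M)) L
          (List.ofFn fun j => ExteriorAlgebra.ι K (u j)).prod := by
  induction r with
  | zero => simp
  | succ r ih =>
    have hsucc (i : Fin r) : (List.ofFn fun j =>
        ExteriorAlgebra.ι K (Function.update u i.succ (L.smulRight k (u i.succ)) j)).prod
        = ExteriorAlgebra.ι K (u 0) * (List.ofFn fun j => ExteriorAlgebra.ι K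
          (Function.update (Fin.tail u) i (L.smulRight k (Fin.tail u i)) j)).prod := by
      rw [List.ofFn_succ, List.prod_cons, Function.update_of_ne (Fin.succ_ne_zero i).symm]
      congr 4 with j
      rw [← Fin.tail_update_succ]
      rfl
    have hanti : ExteriorAlgebra.ι K (u 0) * ExteriorAlgebra.ι K k
        = -(ExteriorAlgebra.ι K k * ExteriorAlgebra.ι K (u 0)) :=
      eq_neg_of_add_eq_zero_left (ExteriorAlgebra.ι_add_mul_swap _ _)
    rw [Fin.sum_univ_succ, Finset.sum_congr rfl fun i _ => hsucc i, ← Finset.mul_sum,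
      ih (Fin.tail u), List.ofFn_succ, List.ofFn_succ, List.prod_cons, List.prod_cons,
      exterior_contractLeft_ι_mul, ← mul_assoc, hanti]
    simp [mul_add, mul_assoc, sub_eq_add_neg, Fin.tail_def]

open CliffordAlgebra in
/-- The endomorphism of the exterior algebra induced by `x ↦ x - L x • v`. -/
theorem map_id_sub_smulRight {M : Type*} [AddCommGroup M] [Module K M]
    (L : Module.Dual K M) (v : M) (x : ExteriorAlgebra K M) :
    ExteriorAlgebra.map (LinearMap.id - L.smulRight v) x
      = x - ExteriorAlgebra.ι K v * contractLeft (Q := (0 : QuadraticForm K M)) L x := by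
  induction x using CliffordAlgebra.left_induction with
  | algebraMap c => simp [contractLeft_algebraMap]
  | add x y hx hy => rw [map_add, hx, hy, map_add, mul_add]; abel
  | ι_mul x u hx =>
    have hanti : ExteriorAlgebra.ι K u * ExteriorAlgebra.ι K v
        = -(ExteriorAlgebra.ι K v * ExteriorAlgebra.ι K u) :=
      eq_neg_of_add_eq_zero_left (ExteriorAlgebra.ι_add_mul_swap _ _)
    have hsq (y : ExteriorAlgebra K M) :
        ExteriorAlgebra.ι K v * (ExteriorAlgebra.ι K v * y) = 0 := by
      rw [← mul_assoc, ExteriorAlgebra.ι_sq_zero, zero_mul]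
    have hswap (y : ExteriorAlgebra K M) : ExteriorAlgebra.ι K u * (ExteriorAlgebra.ι K v * y)
        = -(ExteriorAlgebra.ι K v * (ExteriorAlgebra.ι K u * y)) := by
      rw [← mul_assoc, hanti, neg_mul, mul_assoc]
    change ExteriorAlgebra.map _ (ExteriorAlgebra.ι K u * x) = ExteriorAlgebra.ι K u * x -
      ExteriorAlgebra.ι K v * contractLeft (Q := (0 : QuadraticForm K M)) L
        (ExteriorAlgebra.ι K u * x)
    rw [map_mul, hx, exterior_contractLeft_ι_mul, ExteriorAlgebra.map_apply_ι]
    simp only [LinearMap.sub_apply, LinearMap.id_apply, LinearMap.smulRight_apply, map_sub,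
      map_smul, sub_mul, mul_sub, smul_mul_assoc, mul_smul_comm, hsq, hswap, smul_zero]
    abel

open scoped Pointwise in
/-- Two linear maps on an algebra agreeing on `r`-fold products of elements of `s`
agree on the `r`-th power of the span of `s`. -/
theorem eqOn_span_range_pow {A N ι : Type*} [Ring A] [Algebra K A] [AddCommGroup N] [Module K N]
    {f h : A →ₗ[K] N} {s : ι → A} {r : ℕ}
    (hfh : ∀ c : Fin r → ι, f (List.ofFn fun j => s (c j)).prod
      = h (List.ofFn fun j => s (c j)).prod)
    {x : A} (hx : x ∈ (Submodule.span K (Set.range s)) ^ r) : f x = h x := by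
  rw [Submodule.span_pow] at hx
  refine LinearMap.eqOn_span (s := Set.range s ^ r) (fun y hy => ?_) hx
  obtain ⟨c, rfl⟩ := Set.mem_pow.mp hy
  choose d hd using fun j => (c j).2
  simpa only [hd] using hfh d

open CliffordAlgebra in
theorem contractLeft_eq_zero_of_mem_span_pow {M ι : Type*} [AddCommGroup M] [Module K M]
    {φ : Module.Dual K M} {v : ι → M} (hφ : ∀ i, φ (v i) = 0) {r : ℕ} {x : ExteriorAlgebra K M}
    (hx : x ∈ (Submodule.span K (Set.range fun i => ExteriorAlgebra.ι K (v i))) ^ r) :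
    contractLeft (Q := (0 : QuadraticForm K M)) φ x = 0 := by
  refine eqOn_span_range_pow (h := 0) (fun c => ?_) hx
  clear hx
  induction r with
  | zero => simp
  | succ r ih =>
    rw [List.ofFn_succ, List.prod_cons, exterior_contractLeft_ι_mul, hφ, ih fun j => c j.succ]
    simp

open CliffordAlgebra in
/-- An element of positive degree annihilated by contraction with all dual vectors vanishes,
in any characteristic. -/
theorem eq_zero_of_contractLeft_eq_zero {M ι : Type*} [AddCommGroup M] [Module K M]
    [Fintype ι] [DecidableEq ι] {v : ι → M} {x : ι → Module.Dual K M}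
    (hxv : ∀ i j, x i (v j) = if i = j then 1 else 0) {r : ℕ} (hr : 1 ≤ r)
    {ω : ExteriorAlgebra K M}
    (hω : ω ∈ (Submodule.span K (Set.range fun i => ExteriorAlgebra.ι K (v i))) ^ r)
    (h0 : ∀ i, contractLeft (Q := (0 : QuadraticForm K M)) (x i) ω = 0) : ω = 0 := by
  have key (s : Finset ι) :
      ∃ f : M →ₗ[K] M, (∀ i ∈ s, f (v i) = 0) ∧ ExteriorAlgebra.map f ω = ω := by
    induction s using Finset.induction_on with
    | empty => exact ⟨LinearMap.id, by simp, by simp⟩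
    | insert k s hk ih =>
      obtain ⟨f, hf, hfω⟩ := ih
      refine ⟨f ∘ₗ (LinearMap.id - (x k).smulRight (v k)), fun i hi => ?_, ?_⟩
      · obtain rfl | hne := eq_or_ne k i
        · simp [hxv]
        · simp [hxv, hne, hf i ((Finset.mem_insert.mp hi).resolve_left hne.symm)]
      · rw [← ExteriorAlgebra.map_comp_map, AlgHom.comp_apply, map_id_sub_smulRight, h0,
          mul_zero, sub_zero, hfω]
  obtain ⟨f, hf, hfω⟩ := key Finset.univ
  rw [← hfω]
  refine eqOn_span_range_pow (f := (ExteriorAlgebra.map f).toLinearMap) (h := 0) (fun c => ?_) hω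
  obtain ⟨r, rfl⟩ := Nat.exists_eq_add_of_le' hr
  simp [List.ofFn_succ, hf]

/-- The functionals `L_{a_m}` at distinct nodes span the coordinate functionals. -/
theorem exists_proj_eq_sum_smul_Lfun (g : ℕ) (a : Fin g → K) (ha : Function.Injective a)
    (k : Fin g) : ∃ c : Fin g → K,
      (LinearMap.proj (Sum.inl k) : Vg K g →ₗ[K] K) = ∑ m, c m • Lfun g (a m) := by
  have hdet : IsUnit (Matrix.vandermonde a).det :=
    (Matrix.det_vandermonde_ne_zero_iff.mpr ha).isUnit
  refine ⟨(Matrix.vandermonde a)⁻¹ k, ?_⟩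
  simp only [Lfun, Finset.smul_sum, smul_smul]
  rw [Finset.sum_comm]
  simp only [← Finset.sum_smul]
  have hinv (j : Fin g) : ∑ m, (Matrix.vandermonde a)⁻¹ k m * a m ^ (j : ℕ)
      = if k = j then 1 else 0 := by
    rw [← Matrix.one_apply, ← Matrix.nonsing_inv_mul _ hdet, Matrix.mul_apply]
    rfl
  simp [hinv]

open CliffordAlgebra in
/-- if `ω ∈ ⋀^r(span{v₁,…,v_g})` (with `1 ≤ r ≤ g`) is killed by the
derivation extensions of `C_{a_m}` for `g` pairwise distinct scalars `a₁,…,a_g`,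
then `ω = 0`. -/
theorem ker_on_Vr0 (g r : ℕ) (hr1 : 1 ≤ r) (hrg : r ≤ g)
    (a : Fin g → K) (ha : Function.Injective a)
    (D : Fin g → (ExteriorAlgebra K (Vg K g) →ₗ[K] ExteriorAlgebra K (Vg K g)))
    (hD : ∀ m, IsDerivExt g (a m) r (D m))
    (ω : ExteriorAlgebra K (Vg K g))
    (hω : ω ∈ (Submodule.span K
      (Set.range fun i : Fin g => ExteriorAlgebra.ι K (vv g i))) ^ r)
    (h0 : ∀ m, D m ω = 0) :
    ω = 0 := by
  have hg : 0 < g := by omega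
  have hDω (m : Fin g) : ExteriorAlgebra.ι K (Kvec g (a m)) *
      contractLeft (Q := (0 : QuadraticForm K (Vg K g))) (Lfun g (a m)) ω = 0 := by
    rw [← h0 m]
    refine (eqOn_span_range_pow (f := D m)
      (h := LinearMap.mulLeft K (ExteriorAlgebra.ι K (Kvec g (a m))) ∘ₗ
      contractLeft (Q := (0 : QuadraticForm K (Vg K g))) (Lfun g (a m))) (fun c => ?_) hω).symm
    exact (hD m _).trans (sum_prod_update_smulRight _ _ _ _)
  let φ : Module.Dual K (Vg K g) := LinearMap.proj (Sum.inr ⟨0, hg⟩)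
  have hφω : contractLeft (Q := (0 : QuadraticForm K (Vg K g))) φ ω = 0 :=
    contractLeft_eq_zero_of_mem_span_pow (fun i => by simp [φ, vv]) hω
  have hL (m : Fin g) :
      contractLeft (Q := (0 : QuadraticForm K (Vg K g))) (Lfun g (a m)) ω = 0 := by
    have h := congrArg (contractLeft (Q := (0 : QuadraticForm K (Vg K g))) φ) (hDω m)
    rw [exterior_contractLeft_ι_mul, contractLeft_comm, hφω] at h
    simpa [φ, Kvec] using h
  refine eq_zero_of_contractLeft_eq_zero
    (x := fun k => (LinearMap.proj (Sum.inl k) : Vg K g →ₗ[K] K))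
    (fun i j => by simp [vv, Pi.single_apply]) hr1 hω fun k => ?_
  obtain ⟨c, hc⟩ := exists_proj_eq_sum_smul_Lfun g a ha k
  simp only [hc, map_sum, map_smul, LinearMap.sum_apply, LinearMap.smul_apply, hL, smul_zero,
    Finset.sum_const_zero]
end
end

section
/- Let Δ = Σ_{i=1}^g v_i ∧ w_i in ⋀² V where V has basis v1,…,vg,w1,…,wg, and let f : ⋀^3 V → ⋀^{2g−1} V be wedging with Δ^{∧(g−2)}. Then for the elements β_k = Σ_{a≤k<b≤g} v_{a+b−k} ∧ w_a ∧ w_b (1 ≤ k ≤ g−1), f maps the span X of {α_k, β_k} onto a space of dimension g inside ⋀^{2g−1}V spanned by the γ_i = w_i ∧ (⋀_{j≠i}(v_j∧w_j)); consequently the kernel of f restricted to X has dimension (2g−2) − g = g − 2 (for g ≥ 2). -/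
noncomputable section

variable {K : Type*} [Field K]

/-- `Δ = Σ_{i=1}^g v_i ∧ w_i ∈ ⋀² V`. -/
def deltaE (g : ℕ) : ExteriorAlgebra K (Vg K g) :=
  ∑ i, ExteriorAlgebra.ι K (vv g i) * ExteriorAlgebra.ι K (ww g i)

/-- `f : ⋀³V → ⋀^{2g−1}V`, wedging with `Δ^{∧(g−2)}`. -/
def wedgeDelta (g : ℕ) : ExteriorAlgebra K (Vg K g) →ₗ[K] ExteriorAlgebra K (Vg K g) :=
  LinearMap.mulRight K ((deltaE g) ^ (g - 2))

/-- `γ_i = w_i ∧ (⋀_{j≠i} (v_j ∧ w_j))`. -/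
def gammaE (g : ℕ) (i : Fin g) : ExteriorAlgebra K (Vg K g) :=
  ExteriorAlgebra.ι K (ww g i) *
    (((List.finRange g).filter (fun j => j ≠ i)).map
      (fun j => ExteriorAlgebra.ι K (vv g j) * ExteriorAlgebra.ι K (ww g j))).prod

/-- The span `X` of the elements `α_k, β_k`, `k = 1,…,g−1`. -/
def Xspan (g : ℕ) : Submodule K (ExteriorAlgebra K (Vg K g)) :=
  Submodule.span K
    (Set.range (fun k : Fin (g - 1) => alphaE (K := K) g (k.1 + 1))
      ∪ Set.range (fun k : Fin (g - 1) => betaE (K := K) g (k.1 + 1)))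

section General

variable {R M : Type*} [CommRing R] [AddCommGroup M] [Module R M]

lemma ExteriorAlgebra.ι_mul_ι_swap (x y : M) :
    ExteriorAlgebra.ι R x * ExteriorAlgebra.ι R y
      = -(ExteriorAlgebra.ι R y * ExteriorAlgebra.ι R x) :=
  eq_neg_of_add_eq_zero_left (ExteriorAlgebra.ι_add_mul_swap x y)

lemma ExteriorAlgebra.commute_ι_mul_ι (x y z : M) :
    Commute (ExteriorAlgebra.ι R x * ExteriorAlgebra.ι R y) (ExteriorAlgebra.ι R z) := by
  rw [Commute, SemiconjBy, mul_assoc, ι_mul_ι_swap y z, mul_neg, ← mul_assoc, ι_mul_ι_swap x z,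
    neg_mul, neg_neg, mul_assoc]

lemma add_pow_succ_of_mul_self_eq_zero {A : Type*} [Ring A] {x y : A} (h : Commute x y)
    (hx : x * x = 0) (n : ℕ) : (x + y) ^ (n + 1) = y ^ (n + 1) + (n + 1) • (x * y ^ n) := by
  induction n with
  | zero => simp [add_comm]
  | succ n ih =>
    have hxy : x * y ^ n * x = 0 := by
      rw [mul_assoc, ← (h.pow_right n).eq, ← mul_assoc, hx, zero_mul]
    rw [pow_succ, ih, add_mul, mul_add, smul_mul_assoc, mul_add, hxy, ← (h.pow_right (n + 1)).eq,
      zero_add, mul_assoc, ← pow_succ, ← pow_succ, succ_nsmul _ (n + 1)]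
    abel

lemma List.mul_prod_map_eq_zero {A ι : Type*} [Ring A] {x : ι → A} {y : A} {l : List ι}
    (hc : ∀ i ∈ l, Commute y (x i)) {i : ι} (hi : i ∈ l) (hy : y * x i = 0) :
    y * (l.map x).prod = 0 := by
  induction l with
  | nil => simp at hi
  | cons j l ih =>
    rw [List.map_cons, List.prod_cons, ← mul_assoc]
    rcases List.mem_cons.1 hi with rfl | hi
    · rw [hy, zero_mul]
    · rw [(hc j (by simp)).eq, mul_assoc,
        ih (fun k hk => hc k (List.mem_cons_of_mem _ hk)) hi, mul_zero]

lemma List.sum_map_pow_length {A ι : Type*} [Ring A] {x : ι → A}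
    (hc : ∀ i j, Commute (x i) (x j)) (hx : ∀ i, x i * x i = 0) (l : List ι) :
    (l.map x).sum ^ l.length = l.length.factorial • (l.map x).prod := by
  induction l with
  | nil => simp
  | cons i l ih =>
    have hi : Commute (x i) (l.map x).sum := by
      refine Commute.list_sum_right _ _ fun z hz => ?_
      obtain ⟨j, -, rfl⟩ := List.mem_map.1 hz
      exact hc i j
    have hsum : (l.map x).sum * (l.map x).prod = 0 := by
      rw [← List.sum_map_mul_right]
      refine List.sum_eq_zero fun z hz => ?_
      obtain ⟨j, hj, rfl⟩ := List.mem_map.1 hz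
      exact List.mul_prod_map_eq_zero (fun k _ => hc j k) hj (hx j)
    rw [List.map_cons, List.sum_cons, List.length_cons,
      add_pow_succ_of_mul_self_eq_zero hi (hx i), pow_succ', ih, mul_smul_comm, hsum, smul_zero,
      zero_add, List.prod_cons, mul_smul_comm, smul_smul, Nat.factorial_succ]

lemma linearIndependent_of_diagonal {K E ι : Type*} [Field K] [AddCommGroup E] [Module K E]
    {u : ι → E} (φ : ι → E →ₗ[K] E) (hd : ∀ i, φ i (u i) ≠ 0)
    (ho : ∀ i j, i ≠ j → φ i (u j) = 0) : LinearIndependent K u := by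
  classical
  rw [linearIndependent_iff']
  intro s c hc i hi
  have := congrArg (φ i) hc
  rw [map_sum, Finset.sum_eq_single i] at this
  · simpa [hd i] using this
  · intro j _ hj
    rw [map_smul, ho i j hj.symm, smul_zero]
  · exact fun h => absurd hi h

end General

/-- The product `v_j ∧ w_j`. -/
def pairE (g : ℕ) (j : Fin g) : ExteriorAlgebra K (Vg K g) :=
  ExteriorAlgebra.ι K (vv g j) * ExteriorAlgebra.ι K (ww g j)

lemma pairE_commute_ι (g : ℕ) (j : Fin g) (x : Vg K g) :
    Commute (pairE g j) (ExteriorAlgebra.ι K x) :=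
  ExteriorAlgebra.commute_ι_mul_ι _ _ _

lemma pairE_commute (g : ℕ) (i j : Fin g) : Commute (pairE (K := K) g i) (pairE g j) :=
  (pairE_commute_ι g i _).mul_right (pairE_commute_ι g i _)

lemma vv_mul_pairE (g : ℕ) (j : Fin g) :
    ExteriorAlgebra.ι K (vv g j) * pairE g j = 0 := by
  rw [pairE, ← mul_assoc, ExteriorAlgebra.ι_sq_zero, zero_mul]

lemma ww_mul_pairE (g : ℕ) (j : Fin g) :
    ExteriorAlgebra.ι K (ww g j) * pairE g j = 0 := by
  rw [← (pairE_commute_ι g j _).eq, pairE, mul_assoc, ExteriorAlgebra.ι_sq_zero, mul_zero]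

lemma pairE_mul_self (g : ℕ) (j : Fin g) : pairE (K := K) g j * pairE g j = 0 := by
  rw [pairE, mul_assoc, ← pairE, ww_mul_pairE, mul_zero]

lemma deltaE_eq (g : ℕ) : deltaE (K := K) g = ∑ i, pairE g i := rfl

lemma gammaE_eq (g : ℕ) (i : Fin g) : gammaE (K := K) g i = ExteriorAlgebra.ι K (ww g i) *
    (((List.finRange g).filter (fun j => j ≠ i)).map (pairE g)).prod := rfl

/-- The indices different from `a` and `b`, in increasing order. -/
def offPair (g : ℕ) (a b : Fin g) : List (Fin g) :=
  (List.finRange g).filter (fun j => j ≠ a ∧ j ≠ b)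

lemma cons_offPair_perm {g : ℕ} {a b : Fin g} (hab : a ≠ b) :
    (a :: offPair g a b).Perm ((List.finRange g).filter (fun j => j ≠ b)) := by
  rw [List.perm_ext_iff_of_nodup]
  · intro j
    simp only [offPair, List.mem_cons, List.mem_filter, List.mem_finRange, true_and,
      decide_eq_true_eq]
    by_cases hj : j = a
    · simp [hj, hab]
    · simp [hj]
  · exact List.nodup_cons.2 ⟨by simp [offPair], (List.nodup_finRange g).filter _⟩
  · exact (List.nodup_finRange g).filter _

lemma cons_cons_offPair_perm {g : ℕ} {a b : Fin g} (hab : a ≠ b) :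
    (b :: a :: offPair g a b).Perm (List.finRange g) := by
  rw [List.perm_ext_iff_of_nodup]
  · intro j
    simp only [offPair, List.mem_cons, List.mem_filter, List.mem_finRange, true_and,
      decide_eq_true_eq]
    tauto
  · refine List.nodup_cons.2 ⟨by simp [offPair, hab.symm], List.nodup_cons.2
      ⟨by simp [offPair], (List.nodup_finRange g).filter _⟩⟩
  · exact List.nodup_finRange g

lemma length_offPair {g : ℕ} {a b : Fin g} (hab : a ≠ b) : (offPair g a b).length = g - 2 := by
  have := (cons_cons_offPair_perm hab).length_eq
  simp only [List.length_cons, List.length_finRange] at this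
  omega

lemma prod_map_pairE_perm {g : ℕ} {l l' : List (Fin g)} (h : l.Perm l') :
    (l.map (pairE (K := K) g)).prod = (l'.map (pairE g)).prod := by
  refine (h.map _).prod_eq' (List.pairwise_map.2 ?_)
  exact List.pairwise_of_forall fun i j => pairE_commute g i j

lemma gammaE_eq_mul_offPair {g : ℕ} {a b : Fin g} (hab : a ≠ b) :
    gammaE (K := K) g b = ExteriorAlgebra.ι K (ww g b) *
      (pairE g a * ((offPair g a b).map (pairE g)).prod) := by
  rw [gammaE_eq, ← prod_map_pairE_perm (cons_offPair_perm hab), List.map_cons, List.prod_cons]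

lemma deltaE_eq_add {g : ℕ} {a b : Fin g} (hab : a ≠ b) :
    deltaE (K := K) g = pairE g b + (pairE g a + ((offPair g a b).map (pairE g)).sum) := by
  rw [deltaE_eq, ← List.sum_ofFn, List.ofFn_eq_map,
    ← ((cons_cons_offPair_perm hab).map (pairE g)).sum_eq]
  simp

lemma ww_mul_ww_mul_deltaE_pow {g : ℕ} {a b : Fin g} (hab : a ≠ b) (n : ℕ) :
    ExteriorAlgebra.ι K (ww g a) * ExteriorAlgebra.ι K (ww g b) * deltaE g ^ n
      = ExteriorAlgebra.ι K (ww g a) * ExteriorAlgebra.ι K (ww g b) *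
        ((offPair g a b).map (pairE g)).sum ^ n := by
  induction n with
  | zero => simp
  | succ n ih =>
    have hb : ExteriorAlgebra.ι K (ww g a) * ExteriorAlgebra.ι K (ww g b) * pairE g b = 0 := by
      rw [mul_assoc, ww_mul_pairE, mul_zero]
    have ha : ExteriorAlgebra.ι K (ww g a) * ExteriorAlgebra.ι K (ww g b) * pairE g a = 0 := by
      rw [mul_assoc, ← (pairE_commute_ι g a _).eq, ← mul_assoc, ww_mul_pairE, zero_mul]
    have hy : Commute (ExteriorAlgebra.ι K (ww g a) * ExteriorAlgebra.ι K (ww g b))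
        ((offPair g a b).map (pairE g)).sum := by
      refine Commute.list_sum_right _ _ fun z hz => ?_
      obtain ⟨j, -, rfl⟩ := List.mem_map.1 hz
      exact ((pairE_commute_ι g j _).mul_right (pairE_commute_ι g j _)).symm
    rw [pow_succ', ← mul_assoc]
    nth_rw 1 [deltaE_eq_add hab]
    rw [mul_add, mul_add, hb, ha, zero_add, zero_add, hy.eq, mul_assoc, ih, ← mul_assoc, ← hy.eq,
      mul_assoc, ← pow_succ']

lemma ι_mul_ww_mul_ww_mul_deltaE_pow {g : ℕ} {a b : Fin g} (hab : a ≠ b) (x : Vg K g) :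
    wedgeDelta g (ExteriorAlgebra.ι K x * ExteriorAlgebra.ι K (ww g a) *
        ExteriorAlgebra.ι K (ww g b))
      = (g - 2).factorial • (ExteriorAlgebra.ι K x * ExteriorAlgebra.ι K (ww g a) *
        ExteriorAlgebra.ι K (ww g b) * ((offPair g a b).map (pairE g)).prod) := by
  have h := List.sum_map_pow_length (pairE_commute (K := K) g) (pairE_mul_self g) (offPair g a b)
  rw [length_offPair hab] at h
  rw [wedgeDelta, LinearMap.mulRight_apply, mul_assoc (ExteriorAlgebra.ι K x), mul_assoc,
    ww_mul_ww_mul_deltaE_pow hab, h, mul_smul_comm, mul_smul_comm, ← mul_assoc]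

lemma wedgeDelta_vv_left {g : ℕ} {a b : Fin g} (hab : a ≠ b) :
    wedgeDelta g (ExteriorAlgebra.ι K (vv g a) * ExteriorAlgebra.ι K (ww g a) *
        ExteriorAlgebra.ι K (ww g b)) = (g - 2).factorial • gammaE g b := by
  rw [ι_mul_ww_mul_ww_mul_deltaE_pow hab, gammaE_eq_mul_offPair hab, ← pairE,
    (pairE_commute_ι g a _).eq, mul_assoc]

lemma wedgeDelta_vv_right {g : ℕ} {a b : Fin g} (hab : a ≠ b) :
    wedgeDelta g (ExteriorAlgebra.ι K (vv g b) * ExteriorAlgebra.ι K (ww g a) *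
        ExteriorAlgebra.ι K (ww g b)) = -((g - 2).factorial • gammaE g a) := by
  rw [mul_assoc, ExteriorAlgebra.ι_mul_ι_swap (ww g a), mul_neg, ← mul_assoc, map_neg,
    wedgeDelta_vv_left hab.symm]

lemma wedgeDelta_vv_of_ne {g : ℕ} {a b s : Fin g} (hab : a ≠ b) (hsa : s ≠ a) (hsb : s ≠ b) :
    wedgeDelta g (ExteriorAlgebra.ι K (vv g s) * ExteriorAlgebra.ι K (ww g a) *
        ExteriorAlgebra.ι K (ww g b)) = 0 := by
  have h : ExteriorAlgebra.ι K (vv g s) * ((offPair g a b).map (pairE g)).prod = 0 :=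
    List.mul_prod_map_eq_zero (fun j _ => (pairE_commute_ι g j _).symm)
      (i := s) (by simp [offPair, hsa, hsb]) (vv_mul_pairE g s)
  rw [ι_mul_ww_mul_ww_mul_deltaE_pow hab, mul_assoc (ExteriorAlgebra.ι K (vv g s)),
    ← (ExteriorAlgebra.commute_ι_mul_ι _ _ _).eq, mul_assoc, h, mul_zero, smul_zero]

lemma vext_succ {g : ℕ} (i : Fin g) : vext (K := K) g (i.1 + 1) = vv g i := by
  simp [vext]

lemma wext_succ {g : ℕ} (i : Fin g) : wext (K := K) g (i.1 + 1) = ww g i := by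
  simp [wext]

lemma vext_of_not {g s : ℕ} (h : ¬ (1 ≤ s ∧ s ≤ g)) : vext (K := K) g s = 0 := dif_neg h

lemma exists_fin_succ {g s : ℕ} (h : 1 ≤ s ∧ s ≤ g) : ∃ i : Fin g, s = i.1 + 1 :=
  ⟨⟨s - 1, by omega⟩, by simp; omega⟩

lemma wedgeDelta_vext_of_ne {g s : ℕ} {a b : Fin g} (hab : a ≠ b) (hsa : s ≠ a.1 + 1)
    (hsb : s ≠ b.1 + 1) :
    wedgeDelta g (ExteriorAlgebra.ι K (vext g s) * ExteriorAlgebra.ι K (ww g a) *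
        ExteriorAlgebra.ι K (ww g b)) = 0 := by
  by_cases h : 1 ≤ s ∧ s ≤ g
  · obtain ⟨i, rfl⟩ := exists_fin_succ h
    rw [vext_succ]
    exact wedgeDelta_vv_of_ne hab (by rintro rfl; exact hsa rfl) (by rintro rfl; exact hsb rfl)
  · rw [vext_of_not h, map_zero, zero_mul, zero_mul, map_zero]

lemma wedgeDelta_betaE {g : ℕ} (k : Fin g) :
    wedgeDelta g (betaE (K := K) g (k.1 + 1))
      = -((g - 1 - k) • (g - 2).factorial • gammaE g k) := by
  rw [betaE, map_sum, Finset.sum_eq_single_of_mem (k.1 + 1) (by simp), map_sum]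
  · rw [Finset.sum_congr rfl (g := fun _ => -((g - 2).factorial • gammaE (K := K) g k)),
      Finset.sum_const, Nat.card_Icc, smul_neg]
    · congr 2
      omega
    · intro b hb
      rw [Finset.mem_Icc] at hb
      obtain ⟨b, rfl⟩ := exists_fin_succ (g := g) (s := b) (by omega)
      rw [Nat.add_sub_cancel_left, vext_succ, wext_succ, wext_succ,
        wedgeDelta_vv_right (by rintro rfl; omega)]
  · intro a ha hak
    rw [map_sum]
    refine Finset.sum_eq_zero fun b hb => ?_
    rw [Finset.mem_Icc] at ha hb
    obtain ⟨a, rfl⟩ := exists_fin_succ (g := g) (s := a) (by omega)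
    obtain ⟨b, rfl⟩ := exists_fin_succ (g := g) (s := b) (by omega)
    rw [wext_succ, wext_succ]
    exact wedgeDelta_vext_of_ne (by rintro rfl; omega) (by omega) (by omega)

lemma wedgeDelta_alphaE {g k : ℕ} (hk : k < g) :
    wedgeDelta g (alphaE (K := K) g k) = k • (g - 2).factorial • gammaE g ⟨k, hk⟩ := by
  rw [alphaE, map_sum,
    Finset.sum_congr rfl (g := fun _ => (g - 2).factorial • gammaE (K := K) g ⟨k, hk⟩),
    Finset.sum_const, Nat.card_Icc, Nat.add_sub_cancel]
  intro a ha
  rw [Finset.mem_Icc] at ha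
  obtain ⟨a, rfl⟩ := exists_fin_succ (g := g) (s := a) (by omega)
  have hak : a ≠ ⟨k, hk⟩ := by rintro rfl; simp at ha
  rw [map_sum, Finset.sum_eq_single_of_mem (k + 1) (by simp; omega),
    show a.1 + 1 + (k + 1) - k - 1 = a.1 + 1 by omega, vext_succ, wext_succ,
    show wext (K := K) g (k + 1) = ww g ⟨k, hk⟩ from wext_succ ⟨k, hk⟩, wedgeDelta_vv_left hak]
  intro b hb hbk
  rw [Finset.mem_Icc] at hb
  obtain ⟨b, rfl⟩ := exists_fin_succ (g := g) (s := b) (by omega)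
  rw [wext_succ, wext_succ]
  exact wedgeDelta_vext_of_ne (by rintro rfl; omega) (by omega) (by omega)

lemma map_wedgeDelta_Xspan [CharZero K] {g : ℕ} (hg : 2 ≤ g) :
    Submodule.map (wedgeDelta (K := K) g) (Xspan (K := K) g)
      = Submodule.span K (Set.range (gammaE (K := K) g)) := by
  have key : ∀ {m : ℕ}, m ≠ 0 → ∀ {p : Submodule K (ExteriorAlgebra K (Vg K g))}
      {x : ExteriorAlgebra K (Vg K g)}, m • (g - 2).factorial • x ∈ p → x ∈ p := by
    intro m hm p x hx
    rw [smul_smul, ← Nat.cast_smul_eq_nsmul K] at hx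
    exact (p.smul_mem_iff (Nat.cast_ne_zero.2 (mul_ne_zero hm (Nat.factorial_ne_zero _)))).1 hx
  apply le_antisymm
  · rw [Xspan, Submodule.map_span_le]
    rintro _ (⟨k, rfl⟩ | ⟨k, rfl⟩)
    · simp only
      rw [wedgeDelta_alphaE (by omega)]
      exact nsmul_mem (nsmul_mem (Submodule.subset_span (Set.mem_range_self _)) _) _
    · have := wedgeDelta_betaE (K := K) (g := g) ⟨k.1, by omega⟩
      simp only at this ⊢
      rw [this]
      exact neg_mem (nsmul_mem (nsmul_mem (Submodule.subset_span (Set.mem_range_self _)) _) _)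
  · rw [Submodule.span_le]
    rintro _ ⟨i, rfl⟩
    by_cases hi : i.1 + 1 < g
    · refine key (m := g - 1 - i) (by omega) ?_
      rw [← neg_mem_iff, ← wedgeDelta_betaE]
      exact Submodule.mem_map_of_mem (Submodule.subset_span (Or.inr ⟨⟨i.1, by omega⟩, rfl⟩))
    · obtain ⟨i, hig⟩ := i
      refine key (m := i) (by simp at hi; omega) ?_
      rw [← wedgeDelta_alphaE]
      refine Submodule.mem_map_of_mem (Submodule.subset_span (Or.inl ⟨⟨i - 1, by omega⟩, ?_⟩))
      simp only at hi ⊢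
      congr
      omega

lemma contractLeft_prod_map_pairE {g : ℕ} (d : Module.Dual K (Vg K g)) {l : List (Fin g)}
    (h : ∀ j ∈ l, d (vv g j) = 0 ∧ d (ww g j) = 0) :
    CliffordAlgebra.contractLeft d ((l.map (pairE g)).prod : ExteriorAlgebra K (Vg K g)) = 0 := by
  induction l with
  | nil => exact CliffordAlgebra.contractLeft_one (d := d) 0
  | cons j l ih =>
    obtain ⟨hv, hw⟩ := h j (by simp)
    rw [List.map_cons, List.prod_cons, pairE, mul_assoc, ExteriorAlgebra.ι,
      CliffordAlgebra.contractLeft_ι_mul, CliffordAlgebra.contractLeft_ι_mul, hv, hw,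
      ih fun k hk => h k (List.mem_cons_of_mem _ hk)]
    simp

lemma prod_map_pairE_ne_zero {g : ℕ} {l : List (Fin g)} (hl : l.Nodup) :
    (l.map (pairE (K := K) g)).prod ≠ 0 := by
  induction l with
  | nil => simp
  | cons j l ih =>
    rw [List.nodup_cons] at hl
    have hne : ∀ i ∈ l, i ≠ j := fun i hi hij => hl.1 (hij ▸ hi)
    refine fun h => ih hl.2 ?_
    have hv := contractLeft_prod_map_pairE (K := K) (LinearMap.proj (Sum.inl j)) (l := l)
      fun i hi => by simp [vv, ww, (hne i hi).symm]
    have hw := contractLeft_prod_map_pairE (K := K) (LinearMap.proj (Sum.inr j)) (l := l)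
      fun i hi => by simp [vv, ww, (hne i hi).symm]
    have h2 := congrArg (fun y => CliffordAlgebra.contractLeft (LinearMap.proj (Sum.inr j))
      (CliffordAlgebra.contractLeft (LinearMap.proj (Sum.inl j)) y)) h
    rw [List.map_cons, List.prod_cons, pairE, mul_assoc, ExteriorAlgebra.ι,
      CliffordAlgebra.contractLeft_ι_mul, CliffordAlgebra.contractLeft_ι_mul, hv] at h2
    simpa [vv, ww, CliffordAlgebra.contractLeft_ι_mul, hw] using h2

lemma linearIndependent_gammaE (g : ℕ) : LinearIndependent K (gammaE (K := K) g) := by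
  refine linearIndependent_of_diagonal
    (fun i => LinearMap.mulLeft K (ExteriorAlgebra.ι K (vv g i))) (fun i => ?_) fun i j hij => ?_
  · have hperm : (i :: (List.finRange g).filter (fun j => j ≠ i)).Perm (List.finRange g) := by
      rw [List.perm_ext_iff_of_nodup _ (List.nodup_finRange g)]
      · intro j
        simp [em]
      · exact List.nodup_cons.2 ⟨by simp, (List.nodup_finRange g).filter _⟩
    rw [LinearMap.mulLeft_apply, gammaE_eq, ← mul_assoc, ← pairE, ← List.prod_cons,
      ← List.map_cons, prod_map_pairE_perm hperm]
    exact prod_map_pairE_ne_zero (List.nodup_finRange g)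
  · rw [LinearMap.mulLeft_apply, gammaE_eq, ← mul_assoc, ExteriorAlgebra.ι_mul_ι_swap, neg_mul,
      mul_assoc, List.mul_prod_map_eq_zero (fun k _ => (pairE_commute_ι g k _).symm)
        (i := i) (by simp [hij]) (vv_mul_pairE g i), mul_zero, neg_zero]

/-- The coefficient (as a scalar in the exterior algebra) of `v_s ∧ w_a ∧ w_b`, read off by
successive contractions. -/
def coeffE {g : ℕ} (s a b : Fin g) : ExteriorAlgebra K (Vg K g) →ₗ[K] ExteriorAlgebra K (Vg K g) :=
  CliffordAlgebra.contractLeft (LinearMap.proj (Sum.inr b)) ∘ₗ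
    CliffordAlgebra.contractLeft (LinearMap.proj (Sum.inr a)) ∘ₗ
      CliffordAlgebra.contractLeft (LinearMap.proj (Sum.inl s))

lemma coeffE_vext_mul {g t c d : ℕ} {s a b : Fin g} (hab : a < b) (hc : 1 ≤ c) (hcd : c < d)
    (hd : d ≤ g) :
    coeffE s a b (ExteriorAlgebra.ι K (vext g t) * ExteriorAlgebra.ι K (wext g c)
      * ExteriorAlgebra.ι K (wext g d))
      = if t = s.1 + 1 ∧ c = a.1 + 1 ∧ d = b.1 + 1 then 1 else 0 := by
  obtain ⟨c, rfl⟩ := exists_fin_succ (g := g) (s := c) (by omega)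
  obtain ⟨d, rfl⟩ := exists_fin_succ (g := g) (s := d) (by omega)
  by_cases ht : 1 ≤ t ∧ t ≤ g
  · obtain ⟨t, rfl⟩ := exists_fin_succ ht
    rw [vext_succ, wext_succ, wext_succ, coeffE, mul_assoc, ExteriorAlgebra.ι,
      LinearMap.comp_apply, LinearMap.comp_apply, CliffordAlgebra.contractLeft_ι_mul,
      CliffordAlgebra.contractLeft_ι_mul, CliffordAlgebra.contractLeft_ι]
    by_cases hts : s = t
    · by_cases hac : a = c
      · have hcd' : c.1 ≠ d.1 := by omega
        simp [vv, ww, Pi.single_apply, CliffordAlgebra.contractLeft_ι_mul, hts, hac, Fin.ext_iff,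
          hcd', eq_comm]
      · have hca : c.1 ≠ a.1 := by omega
        by_cases had : a = d
        · subst had
          have hbc : b ≠ c := by omega
          simp [vv, ww, CliffordAlgebra.contractLeft_ι_mul, hts, hac, hca, hbc]
        · simp [vv, ww, CliffordAlgebra.contractLeft_ι_mul, hts, hac, hca, had]
    · have hts' : t.1 ≠ s.1 := by omega
      simp [vv, ww, hts, hts']
  · rw [vext_of_not ht, if_neg (by omega), map_zero, zero_mul, zero_mul, map_zero]

lemma coeffE_sum {g k : ℕ} {s a b : Fin g} (hab : a < b) (σ : ℕ → ℕ → ℕ) :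
    coeffE s a b (∑ c ∈ Finset.Icc 1 k, ∑ d ∈ Finset.Icc (k + 1) g,
        ExteriorAlgebra.ι K (vext g (σ c d)) * ExteriorAlgebra.ι K (wext g c)
          * ExteriorAlgebra.ι K (wext g d))
      = if σ (a.1 + 1) (b.1 + 1) = s.1 + 1 ∧ a.1 < k ∧ k ≤ b.1 then 1 else 0 := by
  have hterm : ∀ c ∈ Finset.Icc 1 k, ∀ d ∈ Finset.Icc (k + 1) g,
      coeffE s a b (ExteriorAlgebra.ι K (vext g (σ c d)) * ExteriorAlgebra.ι K (wext g c)
        * ExteriorAlgebra.ι K (wext g d))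
        = if σ c d = s.1 + 1 ∧ c = a.1 + 1 ∧ d = b.1 + 1 then 1 else 0 := by
    intro c hc d hd
    rw [Finset.mem_Icc] at hc hd
    exact coeffE_vext_mul hab (by omega) (by omega) (by omega)
  simp only [map_sum]
  rw [Finset.sum_congr rfl fun c hc => Finset.sum_congr rfl (hterm c hc)]
  split_ifs with h
  · rw [Finset.sum_eq_single_of_mem (a.1 + 1) (by simp; omega),
      Finset.sum_eq_single_of_mem (b.1 + 1) (by simp; omega), if_pos ⟨h.1, rfl, rfl⟩]
    · exact fun d _ hd => if_neg fun h' => hd h'.2.2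
    · exact fun c _ hc => Finset.sum_eq_zero fun d _ => if_neg fun h' => hc h'.2.1
  · refine Finset.sum_eq_zero fun c hc => Finset.sum_eq_zero fun d hd => if_neg ?_
    rintro ⟨h', rfl, rfl⟩
    rw [Finset.mem_Icc] at hc hd
    exact h ⟨h', by omega, by omega⟩

lemma coeffE_alphaE {g k : ℕ} {s a b : Fin g} (hab : a < b) :
    coeffE s a b (alphaE (K := K) g k)
      = if a.1 + b.1 = s.1 + k ∧ a.1 < k ∧ k ≤ b.1 then 1 else 0 := by
  rw [alphaE, coeffE_sum hab fun c d => c + d - k - 1]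
  exact if_congr (by omega) rfl rfl

lemma coeffE_betaE {g k : ℕ} {s a b : Fin g} (hab : a < b) :
    coeffE s a b (betaE (K := K) g k)
      = if a.1 + b.1 + 1 = s.1 + k ∧ a.1 < k ∧ k ≤ b.1 then 1 else 0 := by
  rw [betaE, coeffE_sum hab fun c d => c + d - k]
  exact if_congr (by omega) rfl rfl

lemma finrank_Xspan (g : ℕ) : Module.finrank K (Xspan (K := K) g) = 2 * (g - 1) := by
  have h : LinearIndependent K (Sum.elim (fun k : Fin (g - 1) => alphaE (K := K) g (k.1 + 1))
      (fun k : Fin (g - 1) => betaE (K := K) g (k.1 + 1))) := by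
    refine linearIndependent_of_diagonal (Sum.elim
      (fun k : Fin (g - 1) =>
        have := k.2
        coeffE (g := g) ⟨0, by omega⟩ ⟨0, by omega⟩ ⟨k.1 + 1, by omega⟩)
      (fun k : Fin (g - 1) =>
        have := k.2
        coeffE (g := g) ⟨g - 1, by omega⟩ ⟨k.1, by omega⟩ ⟨g - 1, by omega⟩)) ?_ ?_
    · rintro (k | k)
      · simp [coeffE_alphaE]
      · simp only [Sum.elim_inr]
        rw [coeffE_betaE (by simp), if_pos (by simp; omega)]
        exact one_ne_zero
    · rintro (k | k) (l | l) hkl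
      · have : k.1 ≠ l.1 := fun h => hkl (by rw [Fin.ext h])
        simp only [Sum.elim_inl]
        rw [coeffE_alphaE (by simp), if_neg (by simp; omega)]
      · simp only [Sum.elim_inl, Sum.elim_inr]
        rw [coeffE_betaE (by simp), if_neg (by simp; omega)]
      · simp only [Sum.elim_inl, Sum.elim_inr]
        rw [coeffE_alphaE (by simp), if_neg (by simp; omega)]
      · have : k.1 ≠ l.1 := fun h => hkl (by rw [Fin.ext h])
        simp only [Sum.elim_inr]
        rw [coeffE_betaE (by simp), if_neg (by simp; omega)]
  rw [Xspan, ← Set.Sum.elim_range, finrank_span_eq_card h, Fintype.card_sum, Fintype.card_fin]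
  omega

instance finiteDimensional_Xspan (g : ℕ) : FiniteDimensional K (Xspan (K := K) g) :=
  FiniteDimensional.span_of_finite K ((Set.finite_range _).union (Set.finite_range _))

/-- for `g ≥ 2` (characteristic zero so that factorials are invertible),
wedging with `Δ^{∧(g−2)}` maps the span `X` of `{α_k, β_k}` onto the `g`-dimensional
space spanned by the `γ_i`; consequently the kernel of `f` restricted to `X` has
dimension `(2g−2) − g = g−2`. -/
theorem wedgeDelta_on_X (g : ℕ) (hg : 2 ≤ g) [CharZero K] :
    Submodule.map (wedgeDelta (K := K) g) (Xspan (K := K) g)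
        = Submodule.span K (Set.range (gammaE (K := K) g))
    ∧ Module.finrank K ↥(Submodule.map (wedgeDelta (K := K) g) (Xspan (K := K) g)) = g
    ∧ Module.finrank K ↥(Xspan (K := K) g ⊓ LinearMap.ker (wedgeDelta (K := K) g))
        = g - 2 := by
  have hmap := map_wedgeDelta_Xspan (K := K) hg
  have hrank : Module.finrank K
      ↥(Submodule.map (wedgeDelta (K := K) g) (Xspan (K := K) g)) = g := by
    rw [hmap, finrank_span_eq_card (linearIndependent_gammaE g), Fintype.card_fin]
  refine ⟨hmap, hrank, ?_⟩
  have h := ((wedgeDelta (K := K) g).domRestrict (Xspan g)).finrank_range_add_finrank_ker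
  rw [LinearMap.range_domRestrict, hrank, finrank_Xspan, LinearMap.ker_domRestrict,
    ← Submodule.finrank_map_subtype_eq, Submodule.map_comap_subtype] at h
  omega
end
end
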